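/- Let a = (1 2)(3 4)(5 6), b = (1 6)(2 3)(4 5) be permutations of {1,…,6}, let f_m be defined by f₀ = id, f_{m+1} = b ∘ f_m for m even, f_{m+1} = a ∘ f_m for m odd, and set σ_m = f_m ∘ a ∘ f_m⁻¹. If m ≡ 2 (mod 6), then the subgroup of permutations of {1,…,6} generated by σ_m and b has exactly three orbits on {1,…,6}; that is, the denominator closure D(SAT^m) = D(SAT^{6k−4}) is a link with three components for every positive integer k. -/

import Mathlib

/-- The involution `a = (1 2)(3 4)(5 6)` (labels `1,…,6` written as `0,…,5`). -/
def permA : Equiv.Perm (Fin 6) := Equiv.swap 0 1 * Equiv.swap 2 3 * Equiv.swap 4 5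

/-- The involution `b = (1 6)(2 3)(4 5)` (labels `1,…,6` written as `0,…,5`). -/
def permB : Equiv.Perm (Fin 6) := Equiv.swap 0 5 * Equiv.swap 1 2 * Equiv.swap 3 4

/-- The connectivity permutation of `SAT^m`: `f₀ = id`, `f_{m+1} = b ∘ f_m` for
`m` even, and `f_{m+1} = a ∘ f_m` for `m` odd. -/
def connPerm : ℕ → Equiv.Perm (Fin 6)
  | 0 => 1
  | m + 1 => if Even m then permB * connPerm m else permA * connPerm m

/-- The outer-endpoint matching involution `σ_m = f_m ∘ a ∘ f_m⁻¹` of `SAT^m`. -/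
def sigmaPerm (m : ℕ) : Equiv.Perm (Fin 6) := connPerm m * permA * (connPerm m)⁻¹

theorem connPerm_add_six {m : ℕ} (hm : Even m) : connPerm (m + 6) = connPerm m := by
  have h1 : permA * (permB * (permA * (permB * (permA * permB)))) = 1 := by decide
  have h2 : connPerm (m + 6) =
      permA * (permB * (permA * (permB * (permA * permB)))) * connPerm m := by
    simp [connPerm, hm, Nat.even_add_one, mul_assoc]
  rw [h2, h1, one_mul]

theorem connPerm_six_mul_add_two (k : ℕ) : connPerm (6 * k + 2) = permA * permB := by
  induction k with
  | zero => simp [connPerm]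
  | succ k ih =>
    have hk : Even (6 * k + 2) := ⟨3 * k + 1, by ring⟩
    rw [← ih, ← connPerm_add_six hk]
    rfl

theorem sigmaPerm_eq_permB {m : ℕ} (h : m % 6 = 2) : sigmaPerm m = permB := by
  obtain ⟨k, rfl⟩ : ∃ k, m = 6 * k + 2 := ⟨m / 6, by omega⟩
  rw [sigmaPerm, connPerm_six_mul_add_two]
  decide

theorem orbitRel_zpowers_eq_sameCycle {α : Type*} (g : Equiv.Perm α) :
    MulAction.orbitRel ↥(Subgroup.zpowers g) α = Equiv.Perm.SameCycle.setoid g := by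
  ext x y
  change x ∈ MulAction.orbit _ y ↔ g.SameCycle x y
  rw [Equiv.Perm.sameCycle_comm]
  constructor
  · rintro ⟨⟨_, i, rfl⟩, hi⟩
    exact ⟨i, hi⟩
  · rintro ⟨i, hi⟩
    exact ⟨⟨_, i, rfl⟩, hi⟩

instance decidableRelSameCyclePermB : DecidableRel (Equiv.Perm.SameCycle.setoid permB).r :=
  inferInstanceAs (DecidableRel (Equiv.Perm.SameCycle permB))

theorem card_quotient_sameCycle_permB :
    Nat.card (Quotient (Equiv.Perm.SameCycle.setoid permB)) = 3 := by
  rw [Nat.card_eq_fintype_card]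
  decide

/-- Lemma 7.1 (three-component case for the denominator closure): if `m ≡ 2 (mod 6)`,
then the subgroup generated by `σ_m` and `b` has exactly three orbits on the six
endpoints, so `D(SAT^m)` is a link with three components. -/
theorem stmt11 (m : ℕ) (h : m % 6 = 2) :
    Nat.card
      (Quotient (MulAction.orbitRel
        ↥(Subgroup.closure {sigmaPerm m, permB}) (Fin 6))) = 3 := by
  rw [sigmaPerm_eq_permB h, Set.pair_eq_singleton, ← Subgroup.zpowers_eq_closure,
    orbitRel_zpowers_eq_sameCycle, card_quotient_sameCycle_permB]
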